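/- arXiv:2404.06630 — 2 statements merged into one kernel-verified Lean document; each statement's English description precedes it below -/
import Mathlib

section
/- Let (Ω, μ) be a measure space, K a finite index type, {D k}_{k ∈ K} measurable subsets of Ω that are pairwise μ-a.e. disjoint with union μ-a.e. equal to Ω, and M : K → Finset K with k ∈ M k for every k; set C k = {j ∈ K : k ∈ M j}. Let u ∈ L²(Ω, μ) and let Π k be linear maps on L²(Ω, μ). Define Su to equal (1/|C k|) ∑_{j ∈ C k} (Π j u) on each D k. Then ‖S u‖²_{L²(Ω, μ)} ≤ ∑_{k ∈ K} ‖Π k u‖²_{M k}, where ‖v‖²_{M k} = ∑_{j ∈ M k} (1/|C j|) ∫_{D j} v² dμ. -/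
open MeasureTheory Finset

/-- The volume-weighted inner product over a merge neighborhood `Mset`:
`(u, v)_{M k} = ∑_{j ∈ Mset} (1/|C j|) ∫_{D j} u·v dμ`. -/
noncomputable def mergeInner {Ω : Type*} [MeasurableSpace Ω] {K : Type*}
    (μ : Measure Ω) (D : K → Set Ω) (C : K → Finset K) (Mset : Finset K)
    (u v : Ω → ℝ) : ℝ :=
  ∑ j ∈ Mset, (1 / ((C j).card : ℝ)) * ∫ x in D j, u x * v x ∂μ

/-- Jensen's inequality for the square of an arithmetic mean over a finite set. -/
lemma sq_one_div_card_mul_sum_le {ι : Type*} (s : Finset ι) (f : ι → ℝ) :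
    ((1 / (s.card : ℝ)) * ∑ i ∈ s, f i) ^ 2 ≤ ∑ i ∈ s, (1 / (s.card : ℝ)) * (f i * f i) := by
  rw [← Finset.mul_sum]
  calc ((1 / (s.card : ℝ)) * ∑ i ∈ s, f i) ^ 2
      = (1 / (s.card : ℝ)) ^ 2 * (∑ i ∈ s, f i) ^ 2 := mul_pow _ _ _
    _ ≤ (1 / (s.card : ℝ)) ^ 2 * (s.card * ∑ i ∈ s, f i ^ 2) := by
        gcongr
        exact sq_sum_le_card_mul_sum_sq
    _ = (1 / (s.card : ℝ)) * ∑ i ∈ s, f i * f i := by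
        simp only [sq (f _)]
        rcases eq_or_ne (s.card : ℝ) 0 with h | h
        · simp [h]
        · field_simp

/-- The integral of a function is the sum of its integrals over the cells of a finite
almost everywhere partition. -/
lemma integral_eq_sum_setIntegral_of_ae_partition {Ω : Type*} [MeasurableSpace Ω]
    {μ : Measure Ω} {K : Type*} [Fintype K] {D : K → Set Ω}
    (hDmeas : ∀ k, MeasurableSet (D k)) (hdisj : ∀ k l, k ≠ l → μ (D k ∩ D l) = 0)
    (hcover : μ ((⋃ k, D k)ᶜ) = 0) {f : Ω → ℝ} (hf : Integrable f μ) :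
    ∫ x, f x ∂μ = ∑ k, ∫ x in D k, f x ∂μ := by
  have hmem : ∀ᵐ x ∂μ, x ∈ ⋃ k, D k := hcover
  rw [← tsum_fintype (L := .unconditional K), ← integral_iUnion_ae
    (fun k => (hDmeas k).nullMeasurableSet) (fun k l h => hdisj k l h) hf.integrableOn,
    Measure.restrict_eq_self_of_ae_mem hmem]

/-- Intermediate bound in the contractivity proof: the squared `L²` norm of
the state-redistributed solution is bounded by the sum of the squared
weighted merge-neighborhood norms of the projected solutions, with no
assumption on the maps `P k` beyond linearity. -/
theorem stateRedistribution_norm_sq_le_sum_mergeNorm_sq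
    {Ω : Type*} [MeasurableSpace Ω] (μ : Measure Ω)
    {K : Type*} [Fintype K]
    (D : K → Set Ω) (hDmeas : ∀ k, MeasurableSet (D k))
    (hdisj : ∀ k l, k ≠ l → μ (D k ∩ D l) = 0)
    (hcover : μ ((⋃ k, D k)ᶜ) = 0)
    (M : K → Finset K) (hM : ∀ k, k ∈ M k)
    (C : K → Finset K) (hC : ∀ k j, j ∈ C k ↔ k ∈ M j)
    (u : Lp ℝ 2 μ)
    (P : K → (Lp ℝ 2 μ →ₗ[ℝ] Lp ℝ 2 μ))
    (Su : Lp ℝ 2 μ)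
    (hS : ∀ k, ∀ᵐ x ∂μ, x ∈ D k →
      Su x = (1 / ((C k).card : ℝ)) * ∑ j ∈ C k, (P j u) x) :
    ‖Su‖ ^ 2 ≤ ∑ k, mergeInner μ D C (M k) (P k u) (P k u) := by
  have hint (v : Lp ℝ 2 μ) : Integrable (fun x => v x * v x) μ := by
    simpa only [sq] using (Lp.memLp v).integrable_sq
  have hnorm : ‖Su‖ ^ 2 = ∫ x, Su x * Su x ∂μ := by
    rw [← real_inner_self_eq_norm_sq, L2.inner_def]
    rfl
  have hcell (k : K) : ∫ x in D k, Su x * Su x ∂μ ≤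
      ∑ j ∈ C k, (1 / ((C k).card : ℝ)) * ∫ x in D k, (P j u) x * (P j u) x ∂μ := by
    have hterm (j : K) : Integrable
        (fun x => (1 / ((C k).card : ℝ)) * ((P j u) x * (P j u) x)) (μ.restrict (D k)) :=
      ((hint (P j u)).const_mul _).integrableOn
    simp only [← integral_const_mul]
    rw [← integral_finsetSum _ fun j _ => hterm j]
    refine integral_mono_ae (hint Su).integrableOn (integrable_finsetSum _ fun j _ => hterm j) ?_
    filter_upwards [(ae_restrict_iff' (hDmeas k)).2 (hS k)] with x hx
    rw [hx, ← sq]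
    exact sq_one_div_card_mul_sum_le (C k) fun j => (P j u) x
  calc ‖Su‖ ^ 2 = ∑ k, ∫ x in D k, Su x * Su x ∂μ := by
        rw [hnorm, integral_eq_sum_setIntegral_of_ae_partition hDmeas hdisj hcover (hint Su)]
    _ ≤ ∑ k, ∑ j ∈ C k, (1 / ((C k).card : ℝ)) * ∫ x in D k, (P j u) x * (P j u) x ∂μ :=
        Finset.sum_le_sum fun k _ => hcell k
    _ = ∑ k, mergeInner μ D C (M k) (P k u) (P k u) :=
        Finset.sum_comm' fun k j => by simp [hC]
end

section
/- Let (Ω, μ) be a measure space, K a finite index type, {D k}_{k ∈ K} measurable subsets of Ω that are pairwise μ-a.e. disjoint with union μ-a.e. equal to Ω, and M : K → Finset K with k ∈ M k for every k; set C k = {j ∈ K : k ∈ M j}. Let u ∈ L²(Ω, μ), and for each k let Π k be a linear map on L²(Ω, μ) for which there is a subspace V k ⊆ L²(Ω, μ) with Π k u ∈ V k and (Π k u, v)_{M k} = (u, v)_{M k} for all v ∈ V k, where (w, v)_{M k} = ∑_{j ∈ M k} (1/|C j|) ∫_{D j} w·v dμ. Then ∑_{k ∈ K} ‖Π k u‖²_{M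 k} ≤ ‖u‖²_{L²(Ω, μ)}. -/
open MeasureTheory Finset

/-- Young's inequality for the weighted merge inner product. -/
theorem two_mul_mergeInner_le {Ω : Type*} [MeasurableSpace Ω] {K : Type*}
    {μ : Measure Ω} (D : K → Set Ω) (C : K → Finset K) (Mset : Finset K) {u v : Ω → ℝ}
    (hu : MemLp u 2 μ) (hv : MemLp v 2 μ) :
    2 * mergeInner μ D C Mset u v ≤ mergeInner μ D C Mset u u + mergeInner μ D C Mset v v := by
  unfold mergeInner
  rw [Finset.mul_sum, ← Finset.sum_add_distrib]
  refine Finset.sum_le_sum fun j _ => ?_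
  have huu : IntegrableOn (fun x => u x * u x) (D j) μ :=
    (hu.integrable_mul hu).integrableOn
  have hvv : IntegrableOn (fun x => v x * v x) (D j) μ :=
    (hv.integrable_mul hv).integrableOn
  have huv : IntegrableOn (fun x => u x * v x) (D j) μ :=
    (hu.integrable_mul hv).integrableOn
  have key : 2 * ∫ x in D j, u x * v x ∂μ
      ≤ (∫ x in D j, u x * u x ∂μ) + ∫ x in D j, v x * v x ∂μ := by
    rw [← integral_const_mul, ← integral_add huu hvv]
    refine integral_mono (huv.const_mul 2) (huu.add hvv) fun x => ?_
    change 2 * (u x * v x) ≤ u x * u x + v x * v x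
    nlinarith [sq_nonneg (u x - v x)]
  have hc : (0 : ℝ) ≤ 1 / ((C j).card : ℝ) := by positivity
  calc _ = 1 / ((C j).card : ℝ) * (2 * ∫ x in D j, u x * v x ∂μ) := by ring
    _ ≤ _ := mul_le_mul_of_nonneg_left key hc
    _ = _ := by ring

/-- The weighted merge inner products sum to the sum of the integrals over the mesh elements. -/
theorem sum_mergeInner {Ω : Type*} [MeasurableSpace Ω] {μ : Measure Ω}
    {K : Type*} [Fintype K] (D : K → Set Ω) (M : K → Finset K) (hM : ∀ k, k ∈ M k)
    (C : K → Finset K) (hC : ∀ k j, j ∈ C k ↔ k ∈ M j) (u v : Ω → ℝ) :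
    ∑ k, mergeInner μ D C (M k) u v = ∑ j, ∫ x in D j, u x * v x ∂μ := by
  unfold mergeInner
  rw [Finset.sum_comm' (t' := Finset.univ) (s' := C) (by simp [hC])]
  refine Finset.sum_congr rfl fun j _ => ?_
  have hj : ((C j).card : ℝ) ≠ 0 :=
    Nat.cast_ne_zero.2 (Finset.card_ne_zero_of_mem ((hC j j).2 (hM j)))
  rw [Finset.sum_const, nsmul_eq_mul]
  field_simp

/-- An integral splits over a finite almost-everywhere partition. -/
theorem sum_setIntegral_of_ae_partition {Ω : Type*} [MeasurableSpace Ω] {μ : Measure Ω}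
    {K : Type*} [Fintype K] {D : K → Set Ω} (hDmeas : ∀ k, MeasurableSet (D k))
    (hdisj : ∀ k l, k ≠ l → μ (D k ∩ D l) = 0) (hcover : μ ((⋃ k, D k)ᶜ) = 0)
    {f : Ω → ℝ} (hf : Integrable f μ) :
    ∑ k, ∫ x in D k, f x ∂μ = ∫ x, f x ∂μ := by
  rw [← tsum_fintype (L := .unconditional K),
    ← integral_iUnion_ae (fun k => (hDmeas k).nullMeasurableSet)
      (fun k l hkl => hdisj k l hkl) hf.integrableOn,
    Measure.restrict_eq_self_of_ae_mem (s := ⋃ k, D k) (mem_ae_iff.2 hcover)]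

/-- Intermediate estimate: if each merge projection `P k` conserves moments
against a local approximation space `V k` in the weighted inner product over
its merge neighborhood, then the sum of the squared weighted merge-neighborhood
norms of the projected solutions is bounded by the squared `L²` norm of `u`. -/
theorem sum_mergeNorm_sq_projections_le_L2_norm_sq
    {Ω : Type*} [MeasurableSpace Ω] (μ : Measure Ω)
    {K : Type*} [Fintype K]
    (D : K → Set Ω) (hDmeas : ∀ k, MeasurableSet (D k))
    (hdisj : ∀ k l, k ≠ l → μ (D k ∩ D l) = 0)
    (hcover : μ ((⋃ k, D k)ᶜ) = 0)
    (M : K → Finset K) (hM : ∀ k, k ∈ M k)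
    (C : K → Finset K) (hC : ∀ k j, j ∈ C k ↔ k ∈ M j)
    (u : Lp ℝ 2 μ)
    (P : K → (Lp ℝ 2 μ →ₗ[ℝ] Lp ℝ 2 μ))
    (V : K → Submodule ℝ (Lp ℝ 2 μ))
    (hPV : ∀ k, P k u ∈ V k)
    (hmom : ∀ k, ∀ v ∈ V k,
      mergeInner μ D C (M k) (P k u) v = mergeInner μ D C (M k) u v) :
    ∑ k, mergeInner μ D C (M k) (P k u) (P k u) ≤ ‖u‖ ^ 2 := by
  have hnorm : ‖u‖ ^ 2 = ∫ x, u x * u x ∂μ := by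
    rw [← real_inner_self_eq_norm_sq, L2.inner_def]
    rfl
  have hint : Integrable (fun x => u x * u x) μ := (Lp.memLp u).integrable_mul (Lp.memLp u)
  rw [hnorm, ← sum_setIntegral_of_ae_partition hDmeas hdisj hcover hint]
  refine le_of_le_of_eq ?_ (sum_mergeInner D M hM C hC u u)
  refine Finset.sum_le_sum fun k _ => ?_
  have h := two_mul_mergeInner_le D C (M k) (Lp.memLp u) (Lp.memLp (P k u))
  rw [← hmom k _ (hPV k)] at h
  linarith
end
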